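/- There exist two trees T and T' on 6 vertices such that |F₂(T) − F₂(T')| < |q₁(T) − q₁(T')|, and consequently for every σ > 0 the graph distance measures satisfy d_{F₂}(T, T') < d_{q₁}(T, T'), where d_I(G, H) = 1 − exp(−((I(G) − I(H))/σ)²). In particular, the conjectured inequality d_{F₂}(T, T') ≥ d_{q₁}(T, T') for all trees T, T' on n vertices is false. -/

import Mathlib

open Classical in
/-- Adjacency matrix of a simple graph, with real entries. -/
noncomputable def adjMat {V : Type*} [Fintype V] (G : SimpleGraph V) : Matrix V V ℝ :=
  fun i j => if G.Adj i j then 1 else 0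

/-- Degree of a vertex, as a real number (row sum of the adjacency matrix). -/
noncomputable def degRe {V : Type*} [Fintype V] (G : SimpleGraph V) (v : V) : ℝ :=
  ∑ j, adjMat G v j

/-- Laplacian matrix `L(G) = D(G) - A(G)`. -/
noncomputable def lapMat {V : Type*} [Fintype V] [DecidableEq V] (G : SimpleGraph V) :
    Matrix V V ℝ :=
  Matrix.diagonal (degRe G) - adjMat G

/-- Largest eigenvalue of the adjacency matrix (which is real symmetric, so its spectrum is a
nonempty finite set of reals). -/
noncomputable def lam1 {V : Type*} [Fintype V] [DecidableEq V] (G : SimpleGraph V) : ℝ :=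
  sSup (spectrum ℝ (adjMat G))

/-- Largest eigenvalue of the Laplacian matrix. -/
noncomputable def q1 {V : Type*} [Fintype V] [DecidableEq V] (G : SimpleGraph V) : ℝ :=
  sSup (spectrum ℝ (lapMat G))

/-- Sum of squared vertex degrees (the second degree power / zeroth Randić index). -/
noncomputable def F2 {V : Type*} [Fintype V] (G : SimpleGraph V) : ℝ :=
  ∑ v, (degRe G v) ^ 2

/-- The graph distance measure `d_I(G,H) = 1 - exp(-((I(G)-I(H))/σ)^2)`, as a function of the
parameter `σ` and the two invariant values `x = I(G)` and `y = I(H)`. -/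
noncomputable def dMeasure (σ x y : ℝ) : ℝ :=
  1 - Real.exp (-(((x - y) / σ) ^ 2))

/-- The spider on six vertices with centre `1` and legs of lengths 1, 1 and 3. -/
def spider113 : SimpleGraph (Fin 6) :=
  SimpleGraph.fromEdgeSet {s(0, 1), s(1, 2), s(2, 3), s(3, 4), s(1, 5)}

/-- The spider on six vertices with centre `2` and legs of lengths 1, 2 and 2. -/
def spider122 : SimpleGraph (Fin 6) :=
  SimpleGraph.fromEdgeSet {s(0, 1), s(1, 2), s(2, 3), s(3, 4), s(2, 5)}

instance : DecidableRel spider113.Adj := by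
  unfold spider113; infer_instance

instance : DecidableRel spider122.Adj := by
  unfold spider122; infer_instance

theorem spider113_isTree : spider113.IsTree := by
  rw [SimpleGraph.isTree_iff_connected_and_card]
  refine ⟨?_, ?_⟩
  · have h1 : spider113.Reachable 1 0 := SimpleGraph.Adj.reachable (by decide)
    have h2 : spider113.Reachable 1 2 := SimpleGraph.Adj.reachable (by decide)
    have h3 : spider113.Reachable 2 3 := SimpleGraph.Adj.reachable (by decide)
    have h4 : spider113.Reachable 3 4 := SimpleGraph.Adj.reachable (by decide)
    have h5 : spider113.Reachable 1 5 := SimpleGraph.Adj.reachable (by decide)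
    rw [SimpleGraph.connected_iff_exists_forall_reachable]
    refine ⟨1, fun w => ?_⟩
    fin_cases w
    exacts [h1, .refl _, h2, h2.trans h3, (h2.trans h3).trans h4, h5]
  · rw [Nat.card_eq_fintype_card, Nat.card_eq_fintype_card, ← SimpleGraph.edgeFinset_card]
    decide

theorem spider122_isTree : spider122.IsTree := by
  rw [SimpleGraph.isTree_iff_connected_and_card]
  refine ⟨?_, ?_⟩
  · have h1 : spider122.Reachable 2 1 := SimpleGraph.Adj.reachable (by decide)
    have h0 : spider122.Reachable 1 0 := SimpleGraph.Adj.reachable (by decide)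
    have h3 : spider122.Reachable 2 3 := SimpleGraph.Adj.reachable (by decide)
    have h4 : spider122.Reachable 3 4 := SimpleGraph.Adj.reachable (by decide)
    have h5 : spider122.Reachable 2 5 := SimpleGraph.Adj.reachable (by decide)
    rw [SimpleGraph.connected_iff_exists_forall_reachable]
    refine ⟨2, fun w => ?_⟩
    fin_cases w
    exacts [h1.trans h0, h1, .refl _, h3, h3.trans h4, h5]
  · rw [Nat.card_eq_fintype_card, Nat.card_eq_fintype_card, ← SimpleGraph.edgeFinset_card]
    decide

theorem F2_eq_sum_degree {V : Type*} [Fintype V] (G : SimpleGraph V) [DecidableRel G.Adj] :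
    F2 G = ((∑ v, G.degree v ^ 2 : ℕ) : ℝ) := by
  have h (v : V) : degRe G v = G.degree v := by
    rw [degRe, ← SimpleGraph.card_neighborFinset_eq_degree,
      SimpleGraph.neighborFinset_eq_filter, Finset.natCast_card_filter]
    exact Finset.sum_congr rfl fun j _ => by simp [adjMat]
  simp [F2, h]

theorem F2_spider113 : F2 spider113 = 20 := by
  rw [F2_eq_sum_degree, show ∑ v, spider113.degree v ^ 2 = 20 by decide]
  norm_num

theorem F2_spider122 : F2 spider122 = 20 := by
  rw [F2_eq_sum_degree, show ∑ v, spider122.degree v ^ 2 = 20 by decide]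
  norm_num

theorem adjMat_spider113 : adjMat spider113 =
    !![0, 1, 0, 0, 0, 0; 1, 0, 1, 0, 0, 1; 0, 1, 0, 1, 0, 0;
       0, 0, 1, 0, 1, 0; 0, 0, 0, 1, 0, 0; 0, 1, 0, 0, 0, 0] := by
  ext i j
  fin_cases i <;> fin_cases j <;> simp [adjMat, spider113]

theorem adjMat_spider122 : adjMat spider122 =
    !![0, 1, 0, 0, 0, 0; 1, 0, 1, 0, 0, 0; 0, 1, 0, 1, 0, 1;
       0, 0, 1, 0, 1, 0; 0, 0, 0, 1, 0, 0; 0, 0, 1, 0, 0, 0] := by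
  ext i j
  fin_cases i <;> fin_cases j <;> simp [adjMat, spider122]

theorem lapMat_spider113 : lapMat spider113 =
    !![1, -1, 0, 0, 0, 0; -1, 3, -1, 0, 0, -1; 0, -1, 2, -1, 0, 0;
       0, 0, -1, 2, -1, 0; 0, 0, 0, -1, 1, 0; 0, -1, 0, 0, 0, 1] := by
  ext i j
  fin_cases i <;> fin_cases j <;>
    simp [lapMat, degRe, adjMat_spider113, Fin.sum_univ_six] <;> norm_num

theorem lapMat_spider122 : lapMat spider122 =
    !![1, -1, 0, 0, 0, 0; -1, 2, -1, 0, 0, 0; 0, -1, 3, -1, 0, -1;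
       0, 0, -1, 2, -1, 0; 0, 0, 0, -1, 1, 0; 0, 0, -1, 0, 0, 1] := by
  ext i j
  fin_cases i <;> fin_cases j <;>
    simp [lapMat, degRe, adjMat_spider122, Fin.sum_univ_six] <;> norm_num

theorem Matrix.mem_spectrum_iff_exists_mulVec_eq_smul {n K : Type*} [Fintype n] [DecidableEq n]
    [Field K] (A : Matrix n n K) (μ : K) :
    μ ∈ spectrum K A ↔ ∃ v : n → K, v ≠ 0 ∧ A.mulVec v = μ • v := by
  rw [← Matrix.spectrum_toLin', ← Module.End.hasEigenvalue_iff_mem_spectrum]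
  constructor
  · intro h
    obtain ⟨v, hv⟩ := h.exists_hasEigenvector
    exact ⟨v, hv.2, by simpa using hv.apply_eq_smul⟩
  · rintro ⟨v, hv, h⟩
    exact Module.End.hasEigenvalue_of_hasEigenvector
      (x := v) ⟨Module.End.mem_eigenspace_iff.2 (by simpa using h), hv⟩

theorem q1_spider113_le : q1 spider113 ≤ 4.3 := by
  refine Real.sSup_le (fun μ hμ => ?_) (by norm_num)
  rw [lapMat_spider113, Matrix.mem_spectrum_iff_exists_mulVec_eq_smul] at hμ
  obtain ⟨v, hv, h⟩ := hμ
  by_contra! hlt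
  refine hv ?_
  have e0 := congrFun h 0
  have e1 := congrFun h 1
  have e2 := congrFun h 2
  have e3 := congrFun h 3
  have e4 := congrFun h 4
  have e5 := congrFun h 5
  simp [Matrix.mulVec, dotProduct, Fin.sum_univ_six] at e0 e1 e2 e3 e4 e5
  have h3 : v 3 = (1 - μ) * v 4 := by linear_combination -e4
  have h2 : v 2 = (μ ^ 2 - 3 * μ + 1) * v 4 := by linear_combination -e3 + (2 - μ) * h3
  have h1 : v 1 = (-μ ^ 3 + 5 * μ ^ 2 - 6 * μ + 1) * v 4 := by
    linear_combination -e2 + (2 - μ) * h2 - h3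
  have h4 : ((-μ ^ 3 + 5 * μ ^ 2 - 6 * μ + 1) * (μ ^ 2 - 4 * μ + 1)
      - (1 - μ) * (μ ^ 2 - 3 * μ + 1)) * v 4 = 0 := by
    linear_combination (1 - μ) * e1 + e0 + e5 - (μ ^ 2 - 4 * μ + 1) * h1 + (1 - μ) * h2
  have h4' : v 4 = 0 := by
    refine (mul_eq_zero.1 h4).resolve_left (ne_of_lt ?_)
    obtain ⟨t, rfl⟩ : ∃ t, μ = 4.3 + t := ⟨μ - 4.3, by ring⟩
    have ht : 0 < t := by linarith
    ring_nf
    nlinarith [pow_pos ht 2, pow_pos ht 3, pow_pos ht 4, pow_pos ht 5]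
  have hμ : 1 - μ ≠ 0 := by linarith
  simp only [h4', mul_zero] at h1 h2 h3
  have h0 : v 0 = 0 := (mul_eq_zero.1 (by linear_combination e0 + h1)).resolve_left hμ
  have h5 : v 5 = 0 := (mul_eq_zero.1 (by linear_combination e5 + h1)).resolve_left hμ
  ext i
  fin_cases i <;> assumption

theorem lt_q1_spider122 : 4.3 < q1 spider122 := by
  have hs : √(13 : ℝ) ^ 2 = 13 := Real.sq_sqrt (by norm_num)
  have hlt : (3.6 : ℝ) < √13 := Real.lt_sqrt_of_sq_lt (by norm_num)
  obtain ⟨μ, hμ⟩ : ∃ μ : ℝ, μ = (5 + √13) / 2 := ⟨_, rfl⟩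
  have hq : μ ^ 2 = 5 * μ - 3 := by rw [hμ]; linear_combination hs / 4
  have hmem : μ ∈ spectrum ℝ (lapMat spider122) := by
    rw [lapMat_spider122, Matrix.mem_spectrum_iff_exists_mulVec_eq_smul]
    refine ⟨![1, 1 - μ, 2 * μ - 2, 1 - μ, 1, -2], fun h => ?_, ?_⟩
    · simpa using congrFun h 0
    · ext i
      fin_cases i <;> simp [Matrix.mulVec, dotProduct, Fin.sum_univ_six] <;>
        linarith [hq]
  exact lt_of_lt_of_le (by rw [hμ]; linarith)
    (le_csSup (Matrix.finite_real_spectrum (A := lapMat spider122)).bddAbove hmem)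

theorem dMeasure_lt_dMeasure {σ x y u v : ℝ} (hσ : 0 < σ) (h : |x - y| < |u - v|) :
    dMeasure σ x y < dMeasure σ u v := by
  have : ((x - y) / σ) ^ 2 < ((u - v) / σ) ^ 2 := by
    rw [sq_lt_sq, abs_div, abs_div]
    exact div_lt_div_of_pos_right h (abs_pos.2 hσ.ne')
  simpa [dMeasure] using this

theorem abs_F2_sub_lt_abs_q1_sub :
    |F2 spider113 - F2 spider122| < |q1 spider113 - q1 spider122| := by
  rw [F2_spider113, F2_spider122, sub_self, abs_zero, abs_pos, sub_ne_zero]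
  exact (q1_spider113_le.trans_lt lt_q1_spider122).ne

/-- There are two trees on 6 vertices with `|F₂(T) - F₂(T')| < |q₁(T) - q₁(T')|`,
hence `d_{F₂}(T,T') < d_{q₁}(T,T')` for every `σ > 0`; in particular the conjectured inequality
`d_{F₂}(T,T') ≥ d_{q₁}(T,T')` for all trees on `n` vertices is false. -/
theorem exists_trees_six_vertices_dF2_lt_dq1 :
    (∃ T T' : SimpleGraph (Fin 6), T.IsTree ∧ T'.IsTree ∧
      |F2 T - F2 T'| < |q1 T - q1 T'| ∧
      ∀ σ : ℝ, 0 < σ → dMeasure σ (F2 T) (F2 T') < dMeasure σ (q1 T) (q1 T')) ∧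
    ¬ (∀ (n : ℕ) (T T' : SimpleGraph (Fin n)), T.IsTree → T'.IsTree →
        ∀ σ : ℝ, 0 < σ → dMeasure σ (F2 T) (F2 T') ≥ dMeasure σ (q1 T) (q1 T')) := by
  exact ⟨⟨spider113, spider122, spider113_isTree, spider122_isTree, abs_F2_sub_lt_abs_q1_sub,
      fun _ hσ => dMeasure_lt_dMeasure hσ abs_F2_sub_lt_abs_q1_sub⟩,
    fun h => (h 6 spider113 spider122 spider113_isTree spider122_isTree 1 one_pos).not_gt
      (dMeasure_lt_dMeasure one_pos abs_F2_sub_lt_abs_q1_sub)⟩
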